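/- As N → ∞, h(N) ∼ 2^{−7/8} G(1/2) π^{−1/4} N^{3/8}; that is, lim_{N→∞} h(N) / N^{3/8} = 2^{−7/8} π^{−1/4} G(1/2), where G is the Barnes G-function. -/

import Mathlib

open Filter

noncomputable section

/-- The Barnes G-function (for real argument), defined by
`G(z+1) = (2π)^{z/2} exp(−((γ+1)z² + z)/2) ∏_{n=1}^{∞} (1 + z/n)^n exp(−z + z²/(2n))`. -/
def BarnesG (w : ℝ) : ℝ :=
  (2 * Real.pi) ^ ((w - 1) / 2) *
    Real.exp (-(((Real.eulerMascheroniConstant + 1) * (w - 1) ^ 2 + (w - 1)) / 2)) *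
    ∏' n : ℕ,
      (1 + (w - 1) / ((n : ℝ) + 1)) ^ (n + 1) *
        Real.exp (-(w - 1) + (w - 1) ^ 2 / (2 * ((n : ℝ) + 1)))

/-- `h N = (2^{-N}/Γ(N)) ∏_{j=1}^{N} Γ(N+j-1)Γ(j) / (Γ(j-1/2)Γ(j+N-3/2))`. -/
def hconst (N : ℕ) : ℝ :=
  (2 : ℝ) ^ (-(N : ℝ)) / Real.Gamma (N : ℝ) *
    ∏ j ∈ Finset.Icc 1 N,
      Real.Gamma ((N : ℝ) + (j : ℝ) - 1) * Real.Gamma (j : ℝ) /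
        (Real.Gamma ((j : ℝ) - 1/2) * Real.Gamma ((j : ℝ) + (N : ℝ) - 3/2))

/-- The ratio `Γ(M+1)/Γ(M+1/2)`. -/
def gammaR (M : ℕ) : ℝ := Real.Gamma ((M : ℝ) + 1) / Real.Gamma ((M : ℝ) + 1/2)

lemma gammaR_pos (M : ℕ) : 0 < gammaR M := by
  unfold gammaR
  have h1 : 0 < Real.Gamma ((M : ℝ) + 1) := Real.Gamma_pos_of_pos (by positivity)
  have h2 : 0 < Real.Gamma ((M : ℝ) + 1/2) := Real.Gamma_pos_of_pos (by positivity)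
  positivity

lemma gammaR_succ (M : ℕ) :
    gammaR (M + 1) = gammaR M * (((M : ℝ) + 1) / ((M : ℝ) + 1/2)) := by
  unfold gammaR
  have h2 : 0 < Real.Gamma ((M : ℝ) + 1/2) := Real.Gamma_pos_of_pos (by positivity)
  have e1 : Real.Gamma (((M + 1 : ℕ) : ℝ) + 1) = ((M : ℝ) + 1) * Real.Gamma ((M : ℝ) + 1) := by
    rw [← Real.Gamma_add_one (by positivity)]; push_cast; rfl
  have e2 : Real.Gamma (((M + 1 : ℕ) : ℝ) + 1/2)
      = ((M : ℝ) + 1/2) * Real.Gamma ((M : ℝ) + 1/2) := by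
    rw [← Real.Gamma_add_one (by positivity)]; push_cast; congr 1; ring
  rw [e1, e2]
  field_simp

lemma gammaR_sq (M : ℕ) :
    gammaR M ^ 2 = (2 * (M : ℝ) + 1) * Real.Wallis.W M / Real.pi := by
  induction M with
  | zero =>
    have : Real.Wallis.W 0 = 1 := by simp [Real.Wallis.W]
    rw [this]
    unfold gammaR
    have h := Real.Gamma_one_half_eq
    simp only [Nat.cast_zero, zero_add, Real.Gamma_one, h]
    rw [div_pow, Real.sq_sqrt Real.pi_pos.le]
    simp
  | succ M ih =>
    rw [gammaR_succ, mul_pow, ih, Real.Wallis.W_succ]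
    have := Real.pi_pos
    push_cast
    field_simp
    ring

lemma gammaR_aux (c : ℝ) :
    Tendsto (fun M : ℕ => (2 * (M : ℝ) + 1) / ((M : ℝ) + c)) atTop (nhds 2) := by
  have h0 : Tendsto (fun M : ℕ => ((M : ℝ))⁻¹) atTop (nhds 0) :=
    tendsto_inv_atTop_nhds_zero_nat
  have h : Tendsto (fun M : ℕ => (2 + ((M : ℝ))⁻¹) / (1 + c * ((M : ℝ))⁻¹)) atTop
      (nhds ((2 + 0) / (1 + c * 0))) :=
    (tendsto_const_nhds.add h0).div (tendsto_const_nhds.add (h0.const_mul c)) (by simp)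
  simp only [add_zero, mul_zero, div_one] at h
  refine h.congr' ?_
  filter_upwards [eventually_ge_atTop 1] with M hM
  have hM' : (M : ℝ) ≠ 0 := by positivity
  rw [← mul_div_mul_left (2 + ((M : ℝ))⁻¹) _ hM']
  congr 1 <;> field_simp

lemma gammaR_lower (M : ℕ) : (M : ℝ) + 1/4 ≤ gammaR M ^ 2 := by
  have hanti : Antitone (fun M : ℕ => gammaR M ^ 2 / ((M : ℝ) + 1/4)) := by
    refine antitone_nat_of_succ_le fun M => ?_
    have hp := gammaR_pos M
    rw [gammaR_succ, mul_pow, mul_div_assoc, div_eq_mul_inv (gammaR M ^ 2)]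
    refine mul_le_mul_of_nonneg_left ?_ (by positivity)
    rw [← one_div, div_pow, div_div, div_le_div_iff₀ (by positivity) (by positivity)]
    push_cast
    nlinarith
  have hlim : Tendsto (fun M : ℕ => gammaR M ^ 2 / ((M : ℝ) + 1/4)) atTop (nhds 1) := by
    have h := ((gammaR_aux (1/4)).mul Real.Wallis.tendsto_W_nhds_pi_div_two).div_const Real.pi
    have e : 2 * (Real.pi / 2) / Real.pi = 1 := by
      have := Real.pi_pos
      field_simp
    rw [e] at h
    refine h.congr fun M => ?_
    rw [gammaR_sq]; ring
  have := hanti.le_of_tendsto hlim M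
  rwa [le_div_iff₀ (by positivity), one_mul] at this

lemma gammaR_upper (M : ℕ) (hM : 1 ≤ M) :
    gammaR M ^ 2 * ((M : ℝ) - 1/4) ≤ (M : ℝ) ^ 2 := by
  have hmono : Monotone (fun M : ℕ =>
      gammaR (M + 1) ^ 2 * (((M : ℝ) + 3/4) / ((M : ℝ) + 1) ^ 2)) := by
    refine monotone_nat_of_le_succ fun M => ?_
    have hp := gammaR_pos (M + 1)
    rw [gammaR_succ (M + 1), mul_pow, mul_assoc]
    refine mul_le_mul_of_nonneg_left ?_ (by positivity)
    push_cast
    rw [div_pow, div_mul_div_comm, div_le_div_iff₀ (by positivity) (by positivity)]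
    have hx : (0 : ℝ) ≤ M := by positivity
    generalize (M : ℝ) = x at *
    have : (x + 3/4) * (x + 1 + 1/2) ^ 2 ≤ (x + 1 + 3/4) * (x + 1) ^ 2 := by nlinarith
    nlinarith [mul_le_mul_of_nonneg_right this (by positivity : (0:ℝ) ≤ (x + 1 + 1) ^ 2)]
  have hlim0 : Tendsto (fun M : ℕ => gammaR M ^ 2 * (((M : ℝ) - 1/4) / (M : ℝ) ^ 2))
      atTop (nhds 1) := by
    have h1 : Tendsto (fun M : ℕ => 1 - 1/4 * ((M : ℝ))⁻¹) atTop (nhds (1 - 1/4 * 0)) :=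
      tendsto_const_nhds.sub (tendsto_inv_atTop_nhds_zero_nat.const_mul _)
    have h := (((gammaR_aux 0).mul
      Real.Wallis.tendsto_W_nhds_pi_div_two).div_const Real.pi).mul h1
    have e : 2 * (Real.pi / 2) / Real.pi * (1 - 1/4 * 0) = 1 := by
      have := Real.pi_pos
      field_simp
      norm_num
    rw [e] at h
    refine h.congr' ?_
    filter_upwards [eventually_ge_atTop 1] with M hM
    have hM' : (M : ℝ) ≠ 0 := by positivity
    rw [gammaR_sq]
    field_simp
    ring
  have hlim : Tendsto (fun M : ℕ =>
      gammaR (M + 1) ^ 2 * (((M : ℝ) + 3/4) / ((M : ℝ) + 1) ^ 2)) atTop (nhds 1) := by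
    refine (hlim0.comp (tendsto_add_atTop_nat 1)).congr fun M => ?_
    simp only [Function.comp]
    push_cast
    congr 2; ring
  obtain ⟨k, rfl⟩ : ∃ k, M = k + 1 := ⟨M - 1, by omega⟩
  have := hmono.ge_of_tendsto hlim k
  rw [← mul_div_assoc, div_le_one (by positivity)] at this
  push_cast
  refine le_trans (le_of_eq ?_) this
  ring

lemma tendsto_b : Tendsto (fun M : ℕ =>
    (M : ℝ) * (Real.log (gammaR M) - 1/2 * Real.log M)) atTop (nhds (1/8)) := by
  have h1 := ((Real.tendsto_mul_log_one_add_div_atTop (1/4)).comp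
    (tendsto_natCast_atTop_atTop (R := ℝ))).const_mul (1/2)
  have h2 := ((Real.tendsto_mul_log_one_add_div_atTop (-(1/4))).comp
    (tendsto_natCast_atTop_atTop (R := ℝ))).const_mul (-(1/2))
  have e1 : (1/2 : ℝ) * (1/4) = 1/8 := by norm_num
  have e2 : (-(1/2) : ℝ) * (-(1/4)) = 1/8 := by norm_num
  rw [e1] at h1
  rw [e2] at h2
  refine tendsto_of_tendsto_of_tendsto_of_le_of_le' h1 h2 ?_ ?_
  · filter_upwards [eventually_ge_atTop 1] with M hM
    have hM' : (0 : ℝ) < M := by positivity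
    have hp := gammaR_pos M
    have h := Real.log_le_log (by positivity) (gammaR_lower M)
    rw [Real.log_pow] at h
    push_cast at h
    simp only [Function.comp]
    have e : 1 + 1/4 / (M : ℝ) = ((M : ℝ) + 1/4) / M := by field_simp
    rw [e, Real.log_div (by positivity) (by positivity)]
    nlinarith [mul_le_mul_of_nonneg_left h hM'.le]
  · filter_upwards [eventually_ge_atTop 1] with M hM
    have hM' : (1 : ℝ) ≤ M := by exact_mod_cast hM
    have hp := gammaR_pos M
    have hq : 0 < (M : ℝ) - 1/4 := by linarith
    have h := Real.log_le_log (by positivity) (gammaR_upper M hM)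
    rw [Real.log_mul (by positivity) hq.ne', Real.log_pow, Real.log_pow] at h
    push_cast at h
    simp only [Function.comp]
    have e : 1 + -(1/4) / (M : ℝ) = ((M : ℝ) - 1/4) / M := by field_simp; ring
    rw [e, Real.log_div hq.ne' (by positivity)]
    nlinarith [mul_le_mul_of_nonneg_left h (by linarith : (0:ℝ) ≤ M)]

lemma tendsto_a : Tendsto (fun M : ℕ =>
    Real.log (gammaR M) - 1/2 * Real.log M) atTop (nhds 0) := by
  have h := tendsto_b.mul (tendsto_inv_atTop_nhds_zero_nat (𝕜 := ℝ))
  rw [mul_zero] at h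
  refine h.congr' ?_
  filter_upwards [eventually_ge_atTop 1] with M hM
  have hM' : (M : ℝ) ≠ 0 := by positivity
  field_simp

/-- Logarithm of the factors in the Weierstrass product at `z = -1/2`. -/
def ell (n : ℕ) : ℝ :=
  ((n : ℝ) + 1) * Real.log (1 - 1 / (2 * ((n : ℝ) + 1))) + 1/2 + 1/8 * ((n : ℝ) + 1)⁻¹

lemma ell_arg_pos (n : ℕ) : 0 < 1 - 1 / (2 * ((n : ℝ) + 1)) := by
  have : 1 / (2 * ((n : ℝ) + 1)) ≤ 1/2 := by
    apply one_div_le_one_div_of_le (by norm_num)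
    have : (0:ℝ) ≤ n := by positivity
    linarith
  linarith

lemma summable_ell : Summable ell := by
  have hs : Summable (fun n : ℕ => 1/4 * (1 / ((n : ℝ) + 1) ^ 2)) := by
    have := (summable_nat_add_iff 1).2 (Real.summable_one_div_nat_pow.2 (one_lt_two))
    push_cast at this
    exact this.mul_left _
  refine Summable.of_norm_bounded hs fun n => ?_
  set k : ℝ := (n : ℝ) + 1 with hk
  have hk1 : 1 ≤ k := by
    have : (0:ℝ) ≤ n := by positivity
    linarith
  have hx0 : 0 < 1 / (2 * k) := by positivity
  have hx : 1 / (2 * k) ≤ 1/2 := by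
    apply one_div_le_one_div_of_le (by norm_num)
    linarith
  have h := Real.abs_log_sub_add_sum_range_le (x := 1 / (2 * k))
    (by rw [abs_of_pos hx0]; linarith) 2
  rw [abs_of_pos hx0] at h
  have e : ell n = k * ((∑ i ∈ Finset.range 2, (1 / (2 * k)) ^ (i + 1) / ((i : ℝ) + 1))
      + Real.log (1 - 1 / (2 * k))) := by
    unfold ell
    simp only [Finset.sum_range_succ, Finset.sum_range_zero, ← hk]
    push_cast
    field_simp
    ring
  rw [e, Real.norm_eq_abs, abs_mul, abs_of_pos (by linarith : 0 < k)]
  calc k * _ ≤ k * ((1 / (2 * k)) ^ (2 + 1) / (1 - 1 / (2 * k))) := by gcongr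
    _ ≤ k * ((1 / (2 * k)) ^ (2 + 1) / (1/2)) := by
      gcongr
      linarith
    _ = 1/4 * (1 / k ^ 2) := by rw [div_pow]; field_simp; ring

lemma BarnesG_half : BarnesG (1/2) =
    (2 * Real.pi) ^ (-(1/4) : ℝ) *
      Real.exp (-(Real.eulerMascheroniConstant / 8) + 1/8) * Real.exp (∑' n, ell n) := by
  unfold BarnesG
  have h := summable_ell.hasSum.rexp.tprod_eq
  rw [← h]
  congr 1
  · congr 2 <;> ring
  · refine tprod_congr fun n => ?_
    have hp := ell_arg_pos n
    have e : 1 + (1/2 - 1) / ((n : ℝ) + 1) = 1 - 1 / (2 * ((n : ℝ) + 1)) := by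
      field_simp; ring
    rw [e]
    simp only [Function.comp, ell]
    rw [add_assoc, Real.exp_add (_ * _)]
    congr 1
    · have e3 : ((n : ℝ) + 1) = ((n + 1 : ℕ) : ℝ) := by push_cast; rfl
      rw [e3] at hp ⊢
      rw [Real.exp_nat_mul, Real.exp_log hp]
    · congr 1
      field_simp
      ring

lemma log_prod (M : ℕ) : ∑ j ∈ Finset.range M, Real.log (gammaR j) =
    (M : ℝ) * Real.log (gammaR M) + ∑ n ∈ Finset.range M, ell n - (M : ℝ) / 2
      - (harmonic M : ℝ) / 8 := by
  induction M with
  | zero => simp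
  | succ M ih =>
    rw [Finset.sum_range_succ, Finset.sum_range_succ, ih, harmonic_succ, gammaR_succ]
    have hp := gammaR_pos M
    have e : ((M : ℝ) + 1) / ((M : ℝ) + 1/2) = (1 - 1 / (2 * ((M : ℝ) + 1)))⁻¹ := by
      have : 1 - 1 / (2 * ((M : ℝ) + 1)) = ((M : ℝ) + 1/2) / ((M : ℝ) + 1) := by
        field_simp; ring
      rw [this, inv_div]
    rw [e, Real.log_mul hp.ne' (inv_ne_zero (ell_arg_pos M).ne'), Real.log_inv]
    unfold ell
    push_cast
    ring

lemma hconst_succ (n : ℕ) : hconst (n + 1) =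
    (2 : ℝ) ^ (-((n : ℝ) + 1)) / (n.factorial : ℝ) *
      ((∏ j ∈ Finset.range (2 * n + 1), gammaR j) * gammaR n) := by
  unfold hconst
  congr 1
  · push_cast
    rw [Real.Gamma_nat_eq_factorial]
  · have h1 : (∏ j ∈ Finset.range (2 * n + 1), gammaR j) * gammaR n =
        ∏ i ∈ Finset.range (n + 1), gammaR i * gammaR (n + i) := by
      rw [show 2 * n + 1 = n + (n + 1) by ring, Finset.prod_range_add, mul_right_comm,
        ← Finset.prod_range_succ, ← Finset.prod_mul_distrib]
    have h2 : Finset.Icc 1 (n + 1) = Finset.Ico (0 + 1) (n + 1 + 1) := by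
      ext j; simp only [Finset.mem_Icc, Finset.mem_Ico]; omega
    rw [h1, h2, ← Finset.prod_Ico_add', Finset.range_eq_Ico]
    refine Finset.prod_congr rfl fun i _ => ?_
    unfold gammaR
    rw [div_mul_div_comm, mul_comm (Real.Gamma ((i : ℝ) + 1))]
    push_cast
    congr 3 <;> ring_nf

theorem hconst_asymptotics :
    Tendsto (fun N : ℕ => hconst N / (N : ℝ) ^ ((3 : ℝ) / 8)) atTop
      (nhds ((2 : ℝ) ^ (-(7 : ℝ) / 8) * Real.pi ^ (-(1 : ℝ) / 4) * BarnesG (1/2))) := by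
  rw [← tendsto_add_atTop_iff_nat 1]
  have hodd : Tendsto (fun n : ℕ => 2 * n + 1) atTop atTop :=
    tendsto_atTop_mono (fun n => by simp only [id]; omega) tendsto_id
  have ta := tendsto_a
  have tb := tendsto_b.comp hodd
  have tc := summable_ell.hasSum.tendsto_sum_nat.comp hodd
  have td := (Real.tendsto_harmonic_sub_log.comp hodd).div_const 8
  have te := Stirling.tendsto_stirlingSeq_sqrt_pi.log (by positivity)
  have tf := (Real.tendsto_mul_log_one_add_div_atTop (1/2)).comp
    (tendsto_natCast_atTop_atTop (R := ℝ))
  have tg := tf.mul (tendsto_inv_atTop_nhds_zero_nat (𝕜 := ℝ))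
  have tk := ((Real.tendsto_mul_log_one_add_div_atTop 1).comp
    (tendsto_natCast_atTop_atTop (R := ℝ))).mul (tendsto_inv_atTop_nhds_zero_nat (𝕜 := ℝ))
  have key := ((((((ta.add tb).add tc).sub td).sub te).add tf).add
    (tg.const_mul (3/8))).sub (tk.const_mul (3/8)) |>.sub_const (9/8 * Real.log 2 + 1/2)
  have key2 := key.rexp
  have hpi := Real.pi_pos
  have hlim : (2 : ℝ) ^ (-(7 : ℝ) / 8) * Real.pi ^ (-(1 : ℝ) / 4) * BarnesG (1/2) =
      Real.exp (0 + 1/8 + ∑' n, ell n - Real.eulerMascheroniConstant / 8 - Real.log (√Real.pi)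
        + 1/2 + 3/8 * (1/2 * 0) - 3/8 * (1 * 0) - (9/8 * Real.log 2 + 1/2)) := by
    rw [BarnesG_half, Real.rpow_def_of_pos (by norm_num), Real.rpow_def_of_pos hpi,
      Real.rpow_def_of_pos (by positivity), Real.log_mul (by norm_num) hpi.ne',
      Real.log_sqrt hpi.le]
    simp only [← Real.exp_add]
    congr 1
    ring
  rw [hlim]
  refine key2.congr' ?_
  filter_upwards [eventually_ge_atTop 1] with n hn
  have hn' : (0 : ℝ) < n := by positivity
  have hG := gammaR_pos n
  have hP : 0 < ∏ j ∈ Finset.range (2 * n + 1), gammaR j :=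
    Finset.prod_pos fun j _ => gammaR_pos j
  have hf : (0 : ℝ) < n.factorial := by positivity
  have hpos : 0 < hconst (n + 1) / ((n + 1 : ℕ) : ℝ) ^ ((3 : ℝ) / 8) := by
    rw [hconst_succ]; positivity
  rw [← Real.exp_log hpos]
  congr 1
  have hs := Stirling.log_stirlingSeq_formula n
  rw [Real.log_div hn'.ne' (Real.exp_pos 1).ne', Real.log_exp,
    Real.log_mul (by norm_num) hn'.ne'] at hs
  rw [hconst_succ, Real.log_div (by positivity) (by positivity),
    Real.log_mul (by positivity) (by positivity), Real.log_div (by positivity) (by positivity),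
    Real.log_mul (by positivity) (by positivity), Real.log_rpow (by norm_num),
    Real.log_rpow (by positivity), Real.log_prod (fun j _ => (gammaR_pos j).ne'), log_prod]
  simp only [Function.comp]
  have e1 : Real.log (1 + 1/2 / (n : ℝ)) =
      Real.log ((2 * n + 1 : ℕ) : ℝ) - Real.log 2 - Real.log n := by
    rw [sub_sub, ← Real.log_mul (by norm_num) hn'.ne',
      ← Real.log_div (by positivity) (by positivity)]
    congr 1
    push_cast
    field_simp
  have e2 : Real.log (1 + 1 / (n : ℝ)) = Real.log ((n + 1 : ℕ) : ℝ) - Real.log n := by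
    rw [← Real.log_div (by positivity) (by positivity)]
    congr 1
    push_cast
    field_simp
  rw [e1, e2, hs]
  generalize Real.log ((2 * n + 1 : ℕ) : ℝ) = l1
  generalize Real.log ((n + 1 : ℕ) : ℝ) = l2
  push_cast
  field_simp
  ring
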